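/- Let d, b, k, n ∈ ℕ and 0 < δ ≤ 1. There exists an estimator V_n, i.e., a measurable map from n-tuples of points in [0,1]^d to the set 𝒟_d of pdfs supported on [0,1]^d, such that for every density p ∈ 𝒟_d having NL-spectrum (w, L), if X_1,…,X_n are i.i.d. with density p then P( ‖p − V_n(X_1,…,X_n)‖_1 > (√3 d / (2b)) ∑_{i=1}^k w_i L_i + 6 ∑_{i=k+1}^∞ w_i + 7√(2bdk·log(4bdkn)/n) + 7√(log(3/δ)/(2n)) ) < δ, where ‖·‖_1 is the L¹ norm with respect to Lebesgue measure. -/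

import Mathlib

open MeasureTheory Filter Finset

noncomputable section

/-- A pdf on `ℝ`: a Lebesgue-measurable, a.e. non-negative function with integral one. -/
def IsPdf1 (f : ℝ → ℝ) : Prop :=
  Measurable f ∧ (∀ᵐ x ∂(volume : Measure ℝ), 0 ≤ f x) ∧ ∫ x, f x = 1

/-- Membership in `𝒟_d`: a pdf on `ℝ^d` supported on the unit cube `[0,1]^d`. -/
def MemD (d : ℕ) (p : (Fin d → ℝ) → ℝ) : Prop :=
  Measurable p ∧ (∀ᵐ x ∂(volume : Measure (Fin d → ℝ)), 0 ≤ p x) ∧ (∫ x, p x = 1) ∧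
    ∀ x, x ∉ Set.Icc (0 : Fin d → ℝ) 1 → p x = 0

/-- `p` has NL-spectrum `(w, L)` (sequences `0`-indexed: index `i` is the paper's `i+1`):
`p = ∑_{i} w_i ∏_j p_{i,j}` a.e., with `w` non-negative summing to one (and `w_1 > 0`),
and each `p_{i,j}` an `L_i`-Lipschitz pdf on `ℝ`. -/
def HasNLSpectrum (d : ℕ) (p : (Fin d → ℝ) → ℝ) (w L : ℕ → ℝ) : Prop :=
  ∃ q : ℕ → Fin d → ℝ → ℝ,
    (∀ i, 0 ≤ w i) ∧ 0 < w 0 ∧ HasSum w 1 ∧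
    (∀ i j, IsPdf1 (q i j) ∧ ∀ x y, |q i j x - q i j y| ≤ L i * |x - y|) ∧
    ∀ᵐ x ∂(volume : Measure (Fin d → ℝ)), p x = ∑' i, w i * ∏ j, q i j (x j)


/-- Two-sided Hoeffding bound for the empirical frequency of a set. -/
lemma hoeffding_set {X : Type*} [MeasurableSpace X] (P : Measure X) [IsProbabilityMeasure P]
    (n : ℕ) (hn : 1 ≤ n) (A : Set X) (hA : MeasurableSet A) (t : ℝ) (ht : 0 ≤ t) :
    (Measure.pi (fun _ : Fin n => P)).real
      {xs | t ≤ |(∑ s, A.indicator (fun _ => (1:ℝ)) (xs s)) / n - P.real A|}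
      ≤ 2 * Real.exp (-2 * n * t ^ 2) := by
  set g : X → ℝ := A.indicator (fun _ => (1:ℝ)) with hg
  have hgm : Measurable g := measurable_const.indicator hA
  have hgi : ∫ x, g x ∂P = P.real A := by
    rw [hg, integral_indicator hA]; simp
  have hgb : ∀ x, g x ∈ Set.Icc (0:ℝ) 1 := by
    intro x; by_cases hx : x ∈ A <;> simp [hg, hx]
  have hnpos : (0:ℝ) < n := by exact_mod_cast hn
  have key : ∀ σ : ℝ, (σ = 1 ∨ σ = -1) → (Measure.pi (fun _ : Fin n => P)).real
      {xs | n * t ≤ ∑ s, σ * (g (xs s) - P.real A)} ≤ Real.exp (-2 * n * t ^ 2) := by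
    intro σ hσ
    have hind : ProbabilityTheory.iIndepFun
        (fun (s : Fin n) (xs : Fin n → X) => σ * (g (xs s) - P.real A))
        (Measure.pi (fun _ : Fin n => P)) :=
      ProbabilityTheory.iIndepFun_pi (X := fun (_ : Fin n) (x : X) => σ * (g x - P.real A))
        (fun i => ((hgm.sub_const _).const_mul σ).aemeasurable)
    have hsub : ∀ s ∈ (Finset.univ : Finset (Fin n)), ProbabilityTheory.HasSubgaussianMGF
        (fun (xs : Fin n → X) => σ * (g (xs s) - P.real A)) ((1/2)^2 : NNReal)
        (Measure.pi (fun _ : Fin n => P)) := by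
      intro s _
      have hmean : ∫ xs : Fin n → X, g (xs s) ∂(Measure.pi (fun _ : Fin n => P)) = P.real A := by
        rw [← hgi]
        exact integral_comp_eval (μ := fun _ : Fin n => P) (i := s) hgm.aestronglyMeasurable
      have h1 := ProbabilityTheory.hasSubgaussianMGF_of_mem_Icc
        (μ := Measure.pi (fun _ : Fin n => P)) (X := fun xs : Fin n → X => g (xs s))
        (a := 0) (b := 1) (hgm.comp (measurable_pi_apply s)).aemeasurable
        (ae_of_all _ fun xs => hgb (xs s))
      rw [hmean] at h1
      have h2 : ((‖(1:ℝ) - 0‖₊ / 2) ^ 2 : NNReal) = (1/2)^2 := by simp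
      rw [h2] at h1
      rcases hσ with rfl | rfl
      · simpa using h1
      · have := h1.neg
        convert! this using 1
        ext xs; simp
    have := ProbabilityTheory.HasSubgaussianMGF.measure_sum_ge_le_of_iIndepFun hind hsub
      (ε := n * t) (by positivity)
    refine this.trans (le_of_eq ?_)
    congr 1
    simp
    field_simp
  have hsubset : {xs : Fin n → X | t ≤ |(∑ s, g (xs s)) / n - P.real A|} ⊆
      {xs | n * t ≤ ∑ s, (1:ℝ) * (g (xs s) - P.real A)} ∪
      {xs | n * t ≤ ∑ s, (-1:ℝ) * (g (xs s) - P.real A)} := by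
    intro xs hxs
    simp only [Set.mem_ofPred_eq, Set.mem_union] at hxs ⊢
    rw [← Finset.mul_sum, ← Finset.mul_sum, Finset.sum_sub_distrib]
    simp only [Finset.sum_const, Finset.card_univ, Fintype.card_fin, nsmul_eq_mul]
    have e : (∑ s, g (xs s)) - n * P.real A = n * ((∑ s, g (xs s)) / n - P.real A) := by
      field_simp
    rw [e]
    rcases le_abs.mp hxs with h | h
    · left; nlinarith
    · right; nlinarith
  calc _ ≤ _ := measureReal_mono hsubset
    _ ≤ _ := measureReal_union_le _ _
    _ ≤ _ := by linarith [key 1 (Or.inl rfl), key (-1) (Or.inr rfl)]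

/-- Scheffe's identity, one half: for two densities the positive part carries half of the `L¹`
distance. -/
lemma scheffe_eq {X : Type*} [MeasurableSpace X] (μ : Measure X) (f g : X → ℝ)
    (hf : Integrable f μ) (hg : Integrable g μ) (h : ∫ x, f x ∂μ = ∫ x, g x ∂μ)
    (hA : MeasurableSet {x | g x < f x}) :
    ∫ x, |f x - g x| ∂μ = 2 * (∫ x in {x | g x < f x}, f x ∂μ - ∫ x in {x | g x < f x}, g x ∂μ) := by
  have h1 : ∫ x, |f x - g x| ∂μ = ∫ x, (2 * ({x | g x < f x}.indicator (fun x => f x - g x) x)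
      - (f x - g x)) ∂μ := by
    congr 1; ext x
    by_cases hx : g x < f x
    · simp [hx, abs_of_pos (sub_pos.2 hx)]; ring
    · simp [hx, abs_of_nonpos (sub_nonpos.2 (not_lt.1 hx))]
  have hi : Integrable (fun x => f x - g x) μ := hf.sub hg
  rw [h1, integral_sub ((hi.indicator hA).const_mul 2) hi, integral_const_mul,
    integral_indicator hA, integral_sub hf.integrableOn hg.integrableOn, integral_sub hf hg, h]
  ring

/-- Scheffe's inequality. -/
lemma scheffe_le {X : Type*} [MeasurableSpace X] (μ : Measure X) (f g : X → ℝ)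
    (hf : Integrable f μ) (hg : Integrable g μ) (h : ∫ x, f x ∂μ = ∫ x, g x ∂μ)
    (A : Set X) (hA : MeasurableSet A) :
    2 * |∫ x in A, f x ∂μ - ∫ x in A, g x ∂μ| ≤ ∫ x, |f x - g x| ∂μ := by
  have hi : Integrable (fun x => f x - g x) μ := hf.sub hg
  have hi' : Integrable (fun x => |f x - g x|) μ := hi.abs
  have h0 : ∫ x in A, (f x - g x) ∂μ + ∫ x in Aᶜ, (f x - g x) ∂μ = 0 := by
    rw [integral_add_compl hA hi, integral_sub hf hg, h, sub_self]
  have h1 : ∫ x in A, |f x - g x| ∂μ + ∫ x in Aᶜ, |f x - g x| ∂μ = ∫ x, |f x - g x| ∂μ :=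
    integral_add_compl hA hi'
  have h2 : |∫ x in A, (f x - g x) ∂μ| ≤ ∫ x in A, |f x - g x| ∂μ := abs_integral_le_integral_abs
  have h3 : |∫ x in Aᶜ, (f x - g x) ∂μ| ≤ ∫ x in Aᶜ, |f x - g x| ∂μ := abs_integral_le_integral_abs
  have h4 : ∫ x in Aᶜ, (f x - g x) ∂μ = - ∫ x in A, (f x - g x) ∂μ := by linarith
  rw [h4, abs_neg] at h3
  rw [← integral_sub hf.integrableOn hg.integrableOn]
  linarith

/-- The minimum distance estimator over a finite family of densities. -/
lemma min_distance {X : Type*} [MeasurableSpace X] (μ : Measure X)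
    {I : Type} [Finite I] [Nonempty I] (f : I → X → ℝ) (hfm : ∀ i, Measurable (f i))
    (hfi : ∀ i, Integrable (f i) μ) (hf1 : ∀ i, ∫ x, f i x ∂μ = 1) (n : ℕ) (hn : 1 ≤ n) :
    ∃ g : (Fin n → X) → I, @Measurable _ _ _ ⊤ g ∧
      ∀ p : X → ℝ, Integrable p μ → (∀ᵐ x ∂μ, 0 ≤ p x) → ∫ x, p x ∂μ = 1 →
        ∀ (i : I) (t : ℝ), 0 ≤ t →
        Measure.pi (fun _ : Fin n => μ.withDensity fun x => ENNReal.ofReal (p x))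
          {xs | 3 * (∫ x, |p x - f i x| ∂μ) + 4 * t < ∫ x, |p x - f (g xs) x| ∂μ}
          ≤ ENNReal.ofReal ((Nat.card I : ℝ) ^ 2 * (2 * Real.exp (-2 * n * t ^ 2))) := by
  classical
  have := Fintype.ofFinite I
  let A : I × I → Set X := fun ij => {x | f ij.2 x < f ij.1 x}
  have hA : ∀ ij, MeasurableSet (A ij) := fun ij => measurableSet_lt (hfm _) (hfm _)
  let T : (Fin n → X) → (Fin n → I × I → Bool) := fun xs s ij => decide (xs s ∈ A ij)
  have hT : Measurable T := by
    refine measurable_pi_lambda _ fun s => measurable_pi_lambda _ fun ij => ?_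
    have h1 : Measurable (fun x : X => decide (x ∈ A ij)) :=
      measurable_to_bool (by simpa [Set.preimage] using hA ij)
    exact h1.comp (measurable_pi_apply s)
  -- empirical frequency
  let emp : (Fin n → I × I → Bool) → I × I → ℝ :=
    fun τ ij => (∑ s, if τ s ij then (1:ℝ) else 0) / n
  let S : (Fin n → I × I → Bool) → I → ℝ := fun τ i =>
    (Finset.univ : Finset (I × I)).sup' Finset.univ_nonempty
      (fun ij => |∫ x in A ij, f i x ∂μ - emp τ ij|)
  have hex : ∀ τ, ∃ i, ∀ i', S τ i ≤ S τ i' := fun τ => Finite.exists_min (S τ)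
  choose m hm using hex
  refine ⟨fun xs => m (T xs), ?_, ?_⟩
  · have : @Measurable _ _ _ ⊤ m := by
      exact @measurable_of_finite _ _ _ ⊤ _ _ m
    exact @Measurable.comp _ _ _ _ _ ⊤ _ _ this hT
  intro p hp hp0 hp1 i t ht
  set P := μ.withDensity fun x => ENNReal.ofReal (p x) with hP
  have hPp : IsProbabilityMeasure P := by
    constructor
    rw [hP, withDensity_apply _ MeasurableSet.univ, Measure.restrict_univ,
      ← ofReal_integral_eq_lintegral_ofReal hp hp0, hp1, ENNReal.ofReal_one]
  have hPA : ∀ ij, P.real (A ij) = ∫ x in A ij, p x ∂μ := by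
    intro ij
    rw [measureReal_def, hP, withDensity_apply _ (hA ij),
      ← ofReal_integral_eq_lintegral_ofReal hp.integrableOn (ae_restrict_of_ae hp0),
      ENNReal.toReal_ofReal (integral_nonneg_of_ae (ae_restrict_of_ae hp0))]
  have hempT : ∀ xs ij, emp (T xs) ij = (∑ s, (A ij).indicator (fun _ => (1:ℝ)) (xs s)) / n := by
    intro xs ij
    simp only [emp, T]
    congr 1
    refine Finset.sum_congr rfl fun s _ => ?_
    by_cases h : xs s ∈ A ij <;> simp [h]
  have hsub : {xs | 3 * (∫ x, |p x - f i x| ∂μ) + 4 * t < ∫ x, |p x - f (m (T xs)) x| ∂μ} ⊆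
      ⋃ ij : I × I, {xs | t ≤ |(∑ s, (A ij).indicator (fun _ => (1:ℝ)) (xs s)) / n - P.real (A ij)|} := by
    intro xs hxs
    by_contra hcon
    simp only [Set.mem_iUnion, Set.mem_ofPred_eq, not_exists, not_le] at hcon hxs
    set j := m (T xs)
    have hS : ∀ i' ij, |∫ x in A ij, f i' x ∂μ - emp (T xs) ij| ≤ S (T xs) i' := fun i' ij =>
      Finset.le_sup' (fun ij => |∫ x in A ij, f i' x ∂μ - emp (T xs) ij|) (Finset.mem_univ ij)
    have hSi : S (T xs) i ≤ t + (∫ x, |p x - f i x| ∂μ) / 2 := by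
      refine Finset.sup'_le _ _ fun ij _ => ?_
      have h1 := hcon ij
      rw [← hempT, hPA] at h1
      have h2 := scheffe_le μ p (f i) hp (hfi i) (by rw [hp1, hf1]) (A ij) (hA ij)
      have h3 := abs_sub_le (∫ x in A ij, f i x ∂μ) (∫ x in A ij, p x ∂μ) (emp (T xs) ij)
      rw [abs_sub_comm (∫ x in A ij, f i x ∂μ) (∫ x in A ij, p x ∂μ),
        abs_sub_comm (∫ x in A ij, p x ∂μ) (emp (T xs) ij)] at h3
      linarith
    have hj : S (T xs) j ≤ S (T xs) i := hm (T xs) i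
    have h5 := scheffe_eq μ (f i) (f j) (hfi i) (hfi j) (by rw [hf1, hf1]) (hA (i, j))
    have h6 := hS i (i, j)
    have h7 := hS j (i, j)
    have h8 : ∫ x, |p x - f j x| ∂μ ≤ ∫ x, |p x - f i x| ∂μ + ∫ x, |f i x - f j x| ∂μ := by
      have e := integral_add (hp.sub (hfi i)).abs ((hfi i).sub (hfi j)).abs
      simp only [Pi.sub_apply] at e
      rw [← e]
      refine integral_mono (hp.sub (hfi j)).abs
        ((hp.sub (hfi i)).abs.add ((hfi i).sub (hfi j)).abs) fun x => ?_
      exact abs_sub_le _ _ _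
    have h9 := le_abs_self (∫ x in A (i, j), f i x ∂μ - emp (T xs) (i, j))
    have h10 := neg_abs_le (∫ x in A (i, j), f j x ∂μ - emp (T xs) (i, j))
    have h11 : ∫ x, |f i x - f j x| ∂μ =
      2 * (∫ x in A (i, j), f i x ∂μ - ∫ x in A (i, j), f j x ∂μ) := h5
    linarith
  refine (measure_mono hsub).trans ?_
  refine (measure_iUnion_fintype_le _ _).trans ?_
  have hb : ∀ ij : I × I, Measure.pi (fun _ : Fin n => P)
      {xs | t ≤ |(∑ s, (A ij).indicator (fun _ => (1:ℝ)) (xs s)) / n - P.real (A ij)|} ≤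
      ENNReal.ofReal (2 * Real.exp (-2 * n * t ^ 2)) := by
    intro ij
    have := hoeffding_set P n hn (A ij) (hA ij) t ht
    rw [measureReal_def] at this
    exact (ENNReal.le_ofReal_iff_toReal_le (measure_ne_top _ _) (by positivity)).2 this
  refine (Finset.sum_le_sum fun ij _ => hb ij).trans ?_
  rw [Finset.sum_const, Finset.card_univ, Fintype.card_prod, nsmul_eq_mul,
    ENNReal.ofReal_mul (p := (Nat.card I : ℝ) ^ 2) (by positivity), Nat.card_eq_fintype_card]
  refine le_of_eq ?_
  congr 1
  rw [ENNReal.ofReal_pow (by positivity), ENNReal.ofReal_natCast]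
  push_cast
  ring

/-- Rounding a probability vector to the grid of multiples of `1/M`. -/
lemma grid_approx (m M : ℕ) (hm : 1 ≤ m) (hM : 1 ≤ M) (v : Fin m → ℝ) (hv : ∀ i, 0 ≤ v i)
    (hv1 : ∑ i, v i = 1) :
    ∃ u : Fin m → Fin (M + 1), (∑ i, ((u i : ℕ) : ℝ) / M = 1) ∧
      ∑ i, |v i - ((u i : ℕ) : ℝ) / M| ≤ 2 * m / M := by
  have hMp : (0:ℝ) < M := by exact_mod_cast hM
  let a : Fin m → ℕ := fun i => ⌊(M:ℝ) * v i⌋₊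
  have ha1 : ∀ i, (a i : ℝ) ≤ M * v i := fun i => Nat.floor_le (mul_nonneg hMp.le (hv i))
  have ha2 : ∀ i, (M:ℝ) * v i ≤ a i + 1 := fun i => (Nat.lt_floor_add_one _).le
  have hsum : ((∑ i, a i : ℕ) : ℝ) ≤ M := by
    push_cast
    calc ∑ i, (a i : ℝ) ≤ ∑ i, (M:ℝ) * v i := Finset.sum_le_sum fun i _ => ha1 i
      _ = M := by rw [← Finset.mul_sum, hv1, mul_one]
  have hsum' : ∑ i, a i ≤ M := by exact_mod_cast hsum
  let r : ℕ := M - ∑ i, a i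
  have hr : (r : ℝ) = M - ∑ i, (a i : ℝ) := by
    simp only [r]; rw [Nat.cast_sub hsum']; push_cast; rfl
  have hr2 : ∑ i, ((M:ℝ) * v i - a i) = r := by
    rw [Finset.sum_sub_distrib, ← Finset.mul_sum, hv1, mul_one, hr]
  have hrm : (r : ℝ) ≤ m := by
    rw [← hr2]
    calc ∑ i, ((M:ℝ) * v i - a i) ≤ ∑ i : Fin m, (1:ℝ) :=
          Finset.sum_le_sum fun i _ => by linarith [ha2 i]
      _ = m := by simp
  let i0 : Fin m := ⟨0, hm⟩
  let c : Fin m → ℕ := fun i => a i + if i = i0 then r else 0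
  have hc : ∑ i, c i = M := by
    simp only [c, Finset.sum_add_distrib, Finset.sum_ite_eq', Finset.mem_univ, if_true, r]
    omega
  have hcle : ∀ i, c i < M + 1 := by
    intro i
    have := Finset.single_le_sum (f := c) (fun i _ => Nat.zero_le _) (Finset.mem_univ i)
    omega
  refine ⟨fun i => ⟨c i, hcle i⟩, ?_, ?_⟩
  · rw [← Finset.sum_div]
    have : ∑ i, (c i : ℝ) = M := by exact_mod_cast hc
    simp only [this]
    exact div_self hMp.ne'
  · have h1 : ∀ i, |v i - (c i : ℝ) / M| ≤ ((M * v i - a i) + if i = i0 then (r:ℝ) else 0) / M := by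
      intro i
      have e : v i - (c i : ℝ) / M = ((M * v i - a i) - if i = i0 then (r:ℝ) else 0) / M := by
        simp only [c]
        push_cast
        field_simp
        ring
      rw [e, abs_div, abs_of_pos hMp]
      refine div_le_div_of_nonneg_right ?_ hMp.le
      refine (abs_sub _ _).trans ?_
      rw [abs_of_nonneg (sub_nonneg.2 (ha1 i)), abs_of_nonneg]
      split_ifs <;> positivity
    calc ∑ i, |v i - (c i : ℝ) / M| ≤
        ∑ i, ((M * v i - a i) + if i = i0 then (r:ℝ) else 0) / M :=
          Finset.sum_le_sum fun i _ => h1 i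
      _ = (r + r) / M := by
          rw [← Finset.sum_div, Finset.sum_add_distrib, hr2]
          simp
      _ ≤ 2 * m / M := by
          refine div_le_div_of_nonneg_right ?_ hMp.le
          linarith

/-- Histogram density with bin masses `v`. -/
def stepFn (b : ℕ) (v : Fin b → ℝ) (x : ℝ) : ℝ :=
  ∑ k : Fin b, (Set.Ico ((k:ℝ) / b) (((k:ℝ) + 1) / b)).indicator (fun _ => (b:ℝ) * v k) x

lemma stepFn_measurable (b : ℕ) (v : Fin b → ℝ) : Measurable (stepFn b v) := by
  unfold stepFn
  exact Finset.measurable_sum _ fun k _ => measurable_const.indicator measurableSet_Ico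

lemma bin_integrable (s t c : ℝ) :
    Integrable ((Set.Ico s t).indicator (fun _ => c)) (volume : Measure ℝ) := by
  rw [integrable_indicator_iff measurableSet_Ico]
  exact integrableOn_const (by simp)

lemma stepFn_integrable (b : ℕ) (v : Fin b → ℝ) : Integrable (stepFn b v) := by
  unfold stepFn
  exact integrable_finsetSum _ fun k _ => bin_integrable _ _ _

lemma stepFn_integral (b : ℕ) (hb : 1 ≤ b) (v : Fin b → ℝ) : ∫ x, stepFn b v x = ∑ k, v k := by
  unfold stepFn
  have hbp : (0:ℝ) < b := by exact_mod_cast hb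
  rw [integral_finsetSum _ fun k _ => bin_integrable _ _ _]
  refine Finset.sum_congr rfl fun k _ => ?_
  rw [integral_indicator measurableSet_Ico]
  have : ((k:ℝ) + 1) / b - k / b = 1 / b := by ring
  simp [this]
  field_simp

lemma stepFn_nonneg (b : ℕ) (v : Fin b → ℝ) (hv : ∀ k, 0 ≤ v k) (x : ℝ) : 0 ≤ stepFn b v x := by
  unfold stepFn
  refine Finset.sum_nonneg fun k _ => Set.indicator_nonneg (fun _ _ => ?_) _
  exact mul_nonneg (Nat.cast_nonneg _) (hv k)

lemma stepFn_support (b : ℕ) (hb : 1 ≤ b) (v : Fin b → ℝ) (x : ℝ) (hx : x ∉ Set.Icc (0:ℝ) 1) :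
    stepFn b v x = 0 := by
  unfold stepFn
  have hbp : (0:ℝ) < b := by exact_mod_cast hb
  refine Finset.sum_eq_zero fun k _ => Set.indicator_of_notMem (fun h => hx ?_) _
  have hk : (k:ℝ) + 1 ≤ b := by exact_mod_cast k.2
  refine ⟨le_trans (by positivity) h.1, h.2.le.trans ?_⟩
  rw [div_le_one hbp]; exact hk

lemma stepFn_sub (b : ℕ) (v v' : Fin b → ℝ) (x : ℝ) :
    stepFn b v x - stepFn b v' x = stepFn b (fun k => v k - v' k) x := by
  unfold stepFn
  rw [← Finset.sum_sub_distrib]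
  refine Finset.sum_congr rfl fun k _ => ?_
  by_cases h : x ∈ Set.Ico ((k:ℝ) / b) (((k:ℝ) + 1) / b)
  · simp only [Set.indicator_of_mem h]; ring
  · simp only [Set.indicator_of_notMem h]; ring

lemma stepFn_abs_le (b : ℕ) (v : Fin b → ℝ) (x : ℝ) :
    |stepFn b v x| ≤ stepFn b (fun k => |v k|) x := by
  unfold stepFn
  refine (Finset.abs_sum_le_sum_abs _ _).trans (Finset.sum_le_sum fun k _ => ?_)
  by_cases h : x ∈ Set.Ico ((k:ℝ) / b) (((k:ℝ) + 1) / b)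
  · simp [h, abs_mul]
  · simp [h]

lemma stepFn_dist (b : ℕ) (hb : 1 ≤ b) (v v' : Fin b → ℝ) :
    ∫ x, |stepFn b v x - stepFn b v' x| ≤ ∑ k, |v k - v' k| := by
  rw [← stepFn_integral b hb (fun k => |v k - v' k|)]
  refine integral_mono ((stepFn_integrable b v).sub (stepFn_integrable b v')).abs
    (stepFn_integrable _ _) fun x => ?_
  simp only [stepFn_sub]
  exact stepFn_abs_le _ _ _

lemma stepFn_eq (b : ℕ) (hb : 1 ≤ b) (v : Fin b → ℝ) (k : Fin b) (x : ℝ)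
    (hx : x ∈ Set.Ico ((k:ℝ) / b) (((k:ℝ) + 1) / b)) : stepFn b v x = b * v k := by
  have hbp : (0:ℝ) < b := by exact_mod_cast hb
  unfold stepFn
  rw [Finset.sum_eq_single k]
  · simp [hx]
  · intro l _ hl
    refine Set.indicator_of_notMem (fun h => hl ?_) _
    obtain ⟨h1, h2⟩ := h
    obtain ⟨h3, h4⟩ := hx
    have h5 : (l:ℝ) / b < ((k:ℝ) + 1) / b := h1.trans_lt h4
    have h6 : (k:ℝ) / b < ((l:ℝ) + 1) / b := h3.trans_lt h2
    rw [div_lt_div_iff_of_pos_right hbp] at h5 h6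
    have h7 : (l:ℕ) < k + 1 := by exact_mod_cast h5
    have h8 : (k:ℕ) < l + 1 := by exact_mod_cast h6
    ext; omega
  · simp

/-- `L¹` distance of a Lipschitz function to its mean over an interval. -/
lemma bin_bias (q : ℝ → ℝ) (L : ℝ) (hL : 0 < L) (hq : ∀ x y, |q x - q y| ≤ L * |x - y|)
    (hc : Continuous q) (s h : ℝ) (hh : 0 < h) :
    ∫ x in s..(s+h), |q x - (∫ y in s..(s+h), q y) / h| ≤ Real.sqrt 3 / 6 * L * h ^ 2 := by
  set m := (∫ y in s..(s+h), q y) / h with hm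
  set A := q (s + h / 2) with hA
  have hle : s ≤ s + h := by linarith
  have i1 : ∫ x in s..(s+h), (q x - m) ^ 2 =
      (∫ x in s..(s+h), (q x - A) ^ 2) - h * (m - A) ^ 2 := by
    have e : ∀ x, (q x - m) ^ 2 = (q x - A) ^ 2 - ((2 * (m - A)) * q x - (m ^ 2 - A ^ 2)) := by
      intro x; ring
    simp_rw [e]
    rw [intervalIntegral.integral_sub, intervalIntegral.integral_sub,
      intervalIntegral.integral_const_mul]
    · simp only [intervalIntegral.integral_const, add_sub_cancel_left, smul_eq_mul]
      have : ∫ y in s..(s+h), q y = h * m := by rw [hm]; field_simp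
      rw [this]; ring
    all_goals exact Continuous.intervalIntegrable (by fun_prop) _ _
  have i2 : ∫ x in s..(s+h), (q x - A) ^ 2 ≤ L ^ 2 * h ^ 3 / 12 := by
    have : ∫ x in s..(s+h), (q x - A) ^ 2 ≤ ∫ x in s..(s+h), L ^ 2 * (x - (s + h / 2)) ^ 2 := by
      refine intervalIntegral.integral_mono_on hle
        (Continuous.intervalIntegrable (by fun_prop) _ _)
        (Continuous.intervalIntegrable (by fun_prop) _ _) fun x _ => ?_
      have := hq x (s + h / 2)
      rw [← sq_abs, ← sq_abs (x - _), ← mul_pow]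
      exact pow_le_pow_left₀ (abs_nonneg _) this 2
    refine this.trans (le_of_eq ?_)
    rw [intervalIntegral.integral_const_mul,
      intervalIntegral.integral_comp_sub_right (fun x => x ^ 2), integral_pow]
    push_cast
    ring
  have i3 : ∫ x in s..(s+h), (q x - m) ^ 2 ≤ L ^ 2 * h ^ 3 / 12 := by
    rw [i1]; nlinarith [sq_nonneg (m - A)]
  set c := Real.sqrt 3 / 6 * L * h with hcdef
  have h3 : Real.sqrt 3 ^ 2 = 3 := Real.sq_sqrt (by norm_num)
  have hs3 : 0 < Real.sqrt 3 := Real.sqrt_pos.2 (by norm_num)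
  have hcpos : 0 < c := by positivity
  have hc2 : c ^ 2 = L ^ 2 * h ^ 2 / 12 := by
    rw [hcdef, mul_pow, mul_pow, div_pow, h3]; ring
  have i4 : ∫ x in s..(s+h), |q x - m| ≤ ∫ x in s..(s+h), ((1 / (2 * c)) * (q x - m) ^ 2 + c / 2) := by
    refine intervalIntegral.integral_mono_on hle
        (Continuous.intervalIntegrable (by fun_prop) _ _)
        (Continuous.intervalIntegrable (by fun_prop) _ _) fun x _ => ?_
    rw [← sq_abs (q x - m)]
    have : 1 / (2 * c) * |q x - m| ^ 2 + c / 2 - |q x - m| = (|q x - m| - c) ^ 2 / (2 * c) := by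
      field_simp; ring
    have : 0 ≤ (|q x - m| - c) ^ 2 / (2 * c) := by positivity
    linarith
  rw [intervalIntegral.integral_add (Continuous.intervalIntegrable (by fun_prop) _ _)
    (Continuous.intervalIntegrable (by fun_prop) _ _), intervalIntegral.integral_const_mul,
    intervalIntegral.integral_const] at i4
  have i5 : 1 / (2 * c) * (∫ x in s..(s+h), (q x - m) ^ 2) ≤ 1 / (2 * c) * (c ^ 2 * h) := by
    refine mul_le_mul_of_nonneg_left ?_ (by positivity)
    rw [hc2]; linarith
  have i6 : 1 / (2 * c) * (c ^ 2 * h) = c * h / 2 := by field_simp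
  have i7 : Real.sqrt 3 / 6 * L * h ^ 2 = c * h := by rw [hcdef]; ring
  rw [i7]
  simp only [add_sub_cancel_left, smul_eq_mul] at i4
  linarith

/-- Histogram bias of a Lipschitz pdf supported on `[0,1]`. -/
lemma hist_bias (b : ℕ) (hb : 1 ≤ b) (q : ℝ → ℝ) (L : ℝ) (hL : 0 < L)
    (hq : ∀ x y, |q x - q y| ≤ L * |x - y|) (hc : Continuous q) (h0 : ∀ x, 0 ≤ q x)
    (hi : Integrable q) (h1 : ∫ x, q x = 1) (hs : ∀ x, x ∉ Set.Icc (0:ℝ) 1 → q x = 0) :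
    ∃ v : Fin b → ℝ, (∀ k, 0 ≤ v k) ∧ ∑ k, v k = 1 ∧
      ∫ x, |q x - stepFn b v x| ≤ Real.sqrt 3 / 6 * L / b := by
  have hbp : (0:ℝ) < b := by exact_mod_cast hb
  have decomp : ∀ F : ℝ → ℝ, Integrable F → (∀ x, x ∉ Set.Icc (0:ℝ) 1 → F x = 0) →
      ∫ x, F x = ∑ k : Fin b, ∫ x in ((k:ℝ)/b)..((k:ℝ)/b + 1/b), F x := by
    intro F hF hF0
    rw [← setIntegral_eq_integral_of_forall_compl_eq_zero hF0, integral_Icc_eq_integral_Ioc,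
      ← intervalIntegral.integral_of_le zero_le_one]
    have := intervalIntegral.sum_integral_adjacent_intervals (f := F) (μ := volume)
      (a := fun k : ℕ => (k:ℝ)/b) (n := b) (fun k _ => hF.intervalIntegrable)
    simp only [Nat.cast_zero, zero_div, div_self hbp.ne'] at this
    rw [← this, Finset.sum_range]
    refine Finset.sum_congr rfl fun k _ => ?_
    congr 1
    push_cast; ring
  have hle : ∀ k : Fin b, (k:ℝ)/b ≤ (k:ℝ)/b + 1/b := fun k => by
    have : 0 < 1 / (b:ℝ) := by positivity
    linarith
  set v : Fin b → ℝ := fun k => ∫ x in ((k:ℝ)/b)..((k:ℝ)/b + 1/b), q x with hv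
  refine ⟨v, fun k => ?_, ?_, ?_⟩
  · exact intervalIntegral.integral_nonneg (hle k) fun x _ => h0 x
  · rw [← h1, decomp q hi hs]
  · rw [decomp (fun x => |q x - stepFn b v x|) (hi.sub (stepFn_integrable b v)).abs
      (fun x hx => by simp [hs x hx, stepFn_support b hb v x hx])]
    have hk : ∀ k : Fin b, ∫ x in ((k:ℝ)/b)..((k:ℝ)/b + 1/b), |q x - stepFn b v x| ≤
        Real.sqrt 3 / 6 * L * (1 / b) ^ 2 := by
      intro k
      refine le_trans (le_of_eq ?_) (bin_bias q L hL hq hc ((k:ℝ)/b) (1/b) (by positivity))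
      rw [intervalIntegral.integral_of_le (hle k), intervalIntegral.integral_of_le (hle k),
        ← integral_Ico_eq_integral_Ioc, ← integral_Ico_eq_integral_Ioc]
      refine setIntegral_congr_fun measurableSet_Ico fun x hx => ?_
      have hx' : x ∈ Set.Ico ((k:ℝ) / b) (((k:ℝ) + 1) / b) := by
        rw [add_div]; exact hx
      have e : (∫ y in ((k:ℝ)/b)..((k:ℝ)/b + 1/b), q y) / (1 / (b:ℝ)) = b * v k := by
        rw [hv]; field_simp
      rw [e]
      simp only [stepFn_eq b hb v k x hx']
    refine (Finset.sum_le_sum fun k _ => hk k).trans (le_of_eq ?_)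
    simp
    field_simp

/-- Subadditivity of the `L¹` distance between product densities. -/
lemma prod_dist (d : ℕ) (f g : Fin d → ℝ → ℝ) (hf0 : ∀ j x, 0 ≤ f j x) (hg0 : ∀ j x, 0 ≤ g j x)
    (hf : ∀ j, Integrable (f j)) (hg : ∀ j, Integrable (g j))
    (hf1 : ∀ j, ∫ x, f j x = 1) (hg1 : ∀ j, ∫ x, g j x = 1) :
    ∫ x : Fin d → ℝ, |∏ j, f j (x j) - ∏ j, g j (x j)| ≤ ∑ j, ∫ x, |f j x - g j x| := by
  let F : Fin d → Fin d → ℝ → ℝ := fun i j x =>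
    if j < i then g j x else if j = i then |f j x - g j x| else f j x
  have hFi : ∀ i j, Integrable (F i j) := by
    intro i j
    simp only [F]
    split_ifs
    · exact hg j
    · exact ((hf j).sub (hg j)).abs
    · exact hf j
  have hFint : ∀ i, ∫ x : Fin d → ℝ, ∏ j, F i j (x j) = ∫ x, |f i x - g i x| := by
    intro i
    rw [integral_fintype_prod_volume_eq_prod, Finset.prod_eq_single i]
    · simp [F]
    · intro j _ hj
      simp only [F]
      split_ifs
      · exact hg1 j
      · exact hf1 j
    · simp
  have hFI : ∀ i, Integrable (fun x : Fin d → ℝ => ∏ j, F i j (x j)) := fun i =>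
    Integrable.fintype_prod (fun j => hFi i j)
  have hpt : ∀ x : Fin d → ℝ, |∏ j, f j (x j) - ∏ j, g j (x j)| ≤ ∑ i, ∏ j, F i j (x j) := by
    intro x
    have := Finset.prod_sub_ordered Finset.univ (fun j => f j (x j)) (fun j => f j (x j) - g j (x j))
    simp only [sub_sub_cancel] at this
    rw [this, sub_sub_cancel]
    refine (Finset.abs_sum_le_sum_abs _ _).trans (Finset.sum_le_sum fun i _ => ?_)
    rw [abs_mul, abs_mul, abs_of_nonneg (Finset.prod_nonneg fun j _ => hg0 j (x j)),
      abs_of_nonneg (Finset.prod_nonneg fun j _ => hf0 j (x j))]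
    refine le_of_eq ?_
    rw [Finset.prod_filter, Finset.prod_filter]
    have e : |f i (x i) - g i (x i)| = ∏ j, if j = i then |f j (x j) - g j (x j)| else 1 := by
      rw [Finset.prod_ite_eq' Finset.univ i]; simp
    rw [e, ← Finset.prod_mul_distrib, ← Finset.prod_mul_distrib]
    refine Finset.prod_congr rfl fun j _ => ?_
    simp only [F]
    rcases lt_trichotomy j i with h | h | h
    · simp [h, h.ne, h.not_gt]
    · simp [h]
    · simp [h, h.ne', h.not_gt]
  have hIf : Integrable (fun x : Fin d → ℝ => ∏ j, f j (x j)) := Integrable.fintype_prod hf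
  have hIg : Integrable (fun x : Fin d → ℝ => ∏ j, g j (x j)) := Integrable.fintype_prod hg
  calc _ ≤ ∫ x : Fin d → ℝ, ∑ i, ∏ j, F i j (x j) :=
        integral_mono (hIf.sub hIg).abs (integrable_finsetSum _ fun i _ => hFI i) hpt
    _ = _ := by
        rw [integral_finsetSum _ fun i _ => hFI i]
        exact Finset.sum_congr rfl fun i _ => hFint i

lemma integrable_of_integral_one {X : Type*} [MeasurableSpace X] {μ : Measure X} {f : X → ℝ}
    (h : ∫ x, f x ∂μ = 1) : Integrable f μ := by
  by_contra hn
  rw [integral_undef hn] at h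
  exact zero_ne_one h

lemma continuous_of_lip (q : ℝ → ℝ) (L : ℝ) (hq : ∀ x y, |q x - q y| ≤ L * |x - y|) :
    Continuous q := by
  have : LipschitzWith (Real.toNNReal L) q := by
    refine LipschitzWith.of_dist_le_mul fun x y => ?_
    rw [Real.dist_eq, Real.dist_eq]
    exact (hq x y).trans (mul_le_mul_of_nonneg_right (Real.le_coe_toNNReal L) (abs_nonneg _))
  exact this.continuous

lemma nonneg_of_ae (q : ℝ → ℝ) (hc : Continuous q) (h : ∀ᵐ x, 0 ≤ q x) (x : ℝ) : 0 ≤ q x := by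
  by_contra hx
  have ho : IsOpen {x | q x < 0} := isOpen_lt hc continuous_const
  have hz : volume {x | q x < 0} = 0 := by
    rw [ae_iff] at h
    simpa using h
  have he := ho.eq_empty_of_measure_zero hz
  have : x ∈ {x | q x < 0} := not_le.1 hx
  rw [he] at this
  exact this

lemma lip_pos (q : ℝ → ℝ) (L : ℝ) (hq : ∀ x y, |q x - q y| ≤ L * |x - y|) (h1 : ∫ x, q x = 1) :
    0 < L := by
  by_contra hL
  have hconst : q = fun _ => q 0 := by
    ext x
    have h2 := hq x 0
    have h3 : L * |x - 0| ≤ 0 := mul_nonpos_of_nonpos_of_nonneg (not_lt.1 hL) (abs_nonneg _)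
    have h4 : |q x - q 0| = 0 := le_antisymm (h2.trans h3) (abs_nonneg _)
    linarith [abs_eq_zero.1 h4]
  rw [hconst] at h1
  simp [measureReal_def] at h1

/-- Summary of the useful consequences of `HasNLSpectrum`. -/
lemma spectrum_facts (d : ℕ) (p : (Fin d → ℝ) → ℝ) (w L : ℕ → ℝ) (q : ℕ → Fin d → ℝ → ℝ)
    (hp : MemD d p) (hw : ∀ i, 0 ≤ w i) (hw1 : HasSum w 1)
    (hq : ∀ i j, IsPdf1 (q i j) ∧ ∀ x y, |q i j x - q i j y| ≤ L i * |x - y|)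
    (hpq : ∀ᵐ x ∂(volume : Measure (Fin d → ℝ)), p x = ∑' i, w i * ∏ j, q i j (x j)) :
    (∀ s : Finset ℕ, ∀ᵐ x ∂(volume : Measure (Fin d → ℝ)),
      ∑ i ∈ s, w i * ∏ j, q i j (x j) ≤ p x) ∧
    (∀ i, 0 < w i → ∀ j x, x ∉ Set.Icc (0:ℝ) 1 → q i j x = 0) := by
  have hc : ∀ i j, Continuous (q i j) := fun i j => continuous_of_lip _ _ (hq i j).2
  have h0 : ∀ i j x, 0 ≤ q i j x := fun i j => nonneg_of_ae _ (hc i j) (hq i j).1.2.1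
  have hi : ∀ i j, Integrable (q i j) := fun i j => integrable_of_integral_one (hq i j).1.2.2
  let Q : ℕ → (Fin d → ℝ) → ℝ := fun i x => ∏ j, q i j (x j)
  have hQc : ∀ i, Continuous (Q i) := fun i =>
    continuous_finsetProd _ fun j _ => (hc i j).comp (continuous_apply j)
  have hQ0 : ∀ i x, 0 ≤ Q i x := fun i x => Finset.prod_nonneg fun j _ => h0 i j _
  have hQi : ∀ i, Integrable (Q i) := fun i => Integrable.fintype_prod (hi i)
  have hQ1 : ∀ i, ∫ x, Q i x = 1 := fun i => by
    simp only [Q]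
    rw [integral_fintype_prod_volume_eq_prod]
    exact Finset.prod_eq_one fun j _ => (hq i j).1.2.2
  have hwQ0 : ∀ i x, 0 ≤ w i * Q i x := fun i x => mul_nonneg (hw i) (hQ0 i x)
  have hsum : ∀ᵐ x ∂(volume : Measure (Fin d → ℝ)), Summable fun i => w i * Q i x := by
    have hlin : ∫⁻ x, ∑' i, ENNReal.ofReal (w i * Q i x) ≠ ⊤ := by
      rw [lintegral_tsum fun i => (((hQc i).measurable.const_mul (w i)).ennreal_ofReal).aemeasurable]
      have : ∀ i, ∫⁻ x, ENNReal.ofReal (w i * Q i x) = ENNReal.ofReal (w i) := by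
        intro i
        rw [← ofReal_integral_eq_lintegral_ofReal ((hQi i).const_mul _)
          (ae_of_all _ (hwQ0 i)), integral_const_mul, hQ1, mul_one]
      simp_rw [this]
      exact hw1.summable.tsum_ofReal_ne_top
    have hmeas : Measurable fun x => ∑' i, ENNReal.ofReal (w i * Q i x) :=
      Measurable.tsum fun i => ((hQc i).measurable.const_mul (w i)).ennreal_ofReal
    filter_upwards [ae_lt_top hmeas hlin] with x hx
    have := ENNReal.summable_toReal hx.ne
    refine this.congr fun i => ?_
    rw [ENNReal.toReal_ofReal (hwQ0 i x)]
  have hpart : ∀ s : Finset ℕ, ∀ᵐ x ∂(volume : Measure (Fin d → ℝ)),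
      ∑ i ∈ s, w i * Q i x ≤ p x := by
    intro s
    filter_upwards [hsum, hpq] with x hx hpx
    rw [hpx]
    exact hx.sum_le_tsum s fun i _ => hwQ0 i x
  refine ⟨hpart, ?_⟩
  intro i hwi
  -- the product vanishes off the cube
  have hQz : ∀ x, x ∉ Set.Icc (0 : Fin d → ℝ) 1 → Q i x = 0 := by
    have hopen : IsOpen {x : Fin d → ℝ | x ∉ Set.Icc (0 : Fin d → ℝ) 1 ∧ Q i x ≠ 0} := by
      refine IsOpen.and ?_ ?_
      · exact isClosed_Icc.isOpen_compl
      · exact isOpen_ne_fun (hQc i) continuous_const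
    have hz : volume {x : Fin d → ℝ | x ∉ Set.Icc (0 : Fin d → ℝ) 1 ∧ Q i x ≠ 0} = 0 := by
      have hae : ∀ᵐ x ∂(volume : Measure (Fin d → ℝ)),
          ¬ (x ∉ Set.Icc (0 : Fin d → ℝ) 1 ∧ Q i x ≠ 0) := by
        filter_upwards [hpart {i}] with x hx hcon
        rw [Finset.sum_singleton, hp.2.2.2 x hcon.1] at hx
        have : w i * Q i x = 0 := le_antisymm hx (hwQ0 i x)
        rcases mul_eq_zero.1 this with h | h
        · exact hwi.ne' h
        · exact hcon.2 h
      rw [ae_iff] at hae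
      simpa using hae
    have he := hopen.eq_empty_of_measure_zero hz
    intro x hx
    by_contra hQ
    have : x ∈ {x : Fin d → ℝ | x ∉ Set.Icc (0 : Fin d → ℝ) 1 ∧ Q i x ≠ 0} := ⟨hx, hQ⟩
    rw [he] at this
    exact this
  have hpos : ∀ j, ∃ x, q i j x ≠ 0 := by
    intro j
    by_contra hcon
    push Not at hcon
    have h1 := (hq i j).1.2.2
    simp [hcon] at h1
  choose y hy using hpos
  intro j x hx
  have hx' : Function.update y j x ∉ Set.Icc (0 : Fin d → ℝ) 1 := by
    intro hmem
    refine hx ⟨?_, ?_⟩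
    · simpa using hmem.1 j
    · simpa using hmem.2 j
  have h1 := hQz _ hx'
  simp only [Q] at h1
  obtain ⟨l, _, hl⟩ := Finset.prod_eq_zero_iff.1 h1
  by_cases hlj : l = j
  · subst hlj; simpa using hl
  · rw [Function.update_of_ne hlj] at hl
    exact absurd hl (hy l)

/-- Probability vectors with entries multiples of `1/M`. -/
def GridVec (m M : ℕ) : Type := {u : Fin m → Fin (M + 1) // ∑ i, ((u i : ℕ) : ℝ) / M = 1}

/-- The entries of a grid probability vector. -/
def GridVec.val' {m M : ℕ} (u : GridVec m M) (i : Fin m) : ℝ := ((u.1 i : ℕ) : ℝ) / M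

instance (m M : ℕ) : Finite (GridVec m M) := by unfold GridVec; infer_instance

lemma GridVec.nonneg {m M : ℕ} (u : GridVec m M) (i : Fin m) : 0 ≤ u.val' i := by
  unfold GridVec.val'; positivity

lemma GridVec.sum_eq {m M : ℕ} (u : GridVec m M) : ∑ i, u.val' i = 1 := u.2

lemma GridVec.card_le (m M : ℕ) : Nat.card (GridVec m M) ≤ (M + 1) ^ m := by
  unfold GridVec
  refine (Finite.card_subtype_le _).trans ?_
  simp [Nat.card_eq_fintype_card]

lemma GridVec.approx (m M : ℕ) (hm : 1 ≤ m) (hM : 1 ≤ M) (v : Fin m → ℝ) (hv : ∀ i, 0 ≤ v i)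
    (hv1 : ∑ i, v i = 1) : ∃ u : GridVec m M, ∑ i, |v i - u.val' i| ≤ 2 * m / M := by
  obtain ⟨u, h1, h2⟩ := grid_approx m M hm hM v hv hv1
  exact ⟨⟨u, h1⟩, h2⟩

lemma GridVec.nonempty (m M : ℕ) (hm : 1 ≤ m) (hM : 1 ≤ M) : Nonempty (GridVec m M) := by
  obtain ⟨u, _⟩ := GridVec.approx m M hm hM (fun i => if i = ⟨0, hm⟩ then 1 else 0)
    (fun i => by split_ifs <;> norm_num) (by simp)
  exact ⟨u⟩

/-- Index set of the candidate densities. -/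
abbrev CandIdx (d b K M : ℕ) : Type := GridVec K M × (Fin K → Fin d → GridVec b M)

/-- Product histogram. -/
def prodHist {d b M : ℕ} (a : Fin d → GridVec b M) (x : Fin d → ℝ) : ℝ :=
  ∏ j, stepFn b (a j).val' (x j)

/-- Candidate density: mixture of product histograms. -/
def cand {d b K M : ℕ} (θ : CandIdx d b K M) (x : Fin d → ℝ) : ℝ :=
  ∑ i, θ.1.val' i * prodHist (θ.2 i) x

lemma prodHist_measurable {d b M : ℕ} (a : Fin d → GridVec b M) : Measurable (prodHist a) := by
  unfold prodHist
  exact Finset.measurable_prod _ fun j _ => (stepFn_measurable _ _).comp (measurable_pi_apply j)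

lemma prodHist_integrable {d b M : ℕ} (a : Fin d → GridVec b M) : Integrable (prodHist a) :=
  Integrable.fintype_prod (f := fun j => stepFn b (a j).val') fun _ => stepFn_integrable _ _

lemma prodHist_nonneg {d b M : ℕ} (a : Fin d → GridVec b M) (x : Fin d → ℝ) : 0 ≤ prodHist a x :=
  Finset.prod_nonneg fun j _ => stepFn_nonneg _ _ (fun k => (a j).nonneg k) _

lemma prodHist_integral {d b M : ℕ} (hb : 1 ≤ b) (a : Fin d → GridVec b M) :
    ∫ x, prodHist a x = 1 := by
  unfold prodHist
  rw [integral_fintype_prod_volume_eq_prod (fun j => stepFn b (a j).val')]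
  refine Finset.prod_eq_one fun j _ => ?_
  rw [stepFn_integral b hb, GridVec.sum_eq]

lemma prodHist_support {d b M : ℕ} (hb : 1 ≤ b) (a : Fin d → GridVec b M) (x : Fin d → ℝ)
    (hx : x ∉ Set.Icc (0 : Fin d → ℝ) 1) : prodHist a x = 0 := by
  have : ∃ j, x j ∉ Set.Icc (0:ℝ) 1 := by
    by_contra hcon
    push Not at hcon
    exact hx ⟨fun j => (hcon j).1, fun j => (hcon j).2⟩
  obtain ⟨j, hj⟩ := this
  exact Finset.prod_eq_zero (Finset.mem_univ j) (stepFn_support b hb _ _ hj)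

lemma cand_measurable {d b K M : ℕ} (θ : CandIdx d b K M) : Measurable (cand θ) := by
  unfold cand
  exact Finset.measurable_sum _ fun i _ => (prodHist_measurable _).const_mul _

lemma cand_integrable {d b K M : ℕ} (θ : CandIdx d b K M) : Integrable (cand θ) := by
  unfold cand
  exact integrable_finsetSum _ fun i _ => (prodHist_integrable _).const_mul _

lemma cand_integral {d b K M : ℕ} (hb : 1 ≤ b) (θ : CandIdx d b K M) : ∫ x, cand θ x = 1 := by
  unfold cand
  rw [integral_finsetSum _ fun i _ => (prodHist_integrable _).const_mul _]
  simp_rw [integral_const_mul, prodHist_integral hb, mul_one]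
  exact θ.1.sum_eq

lemma cand_memD {d b K M : ℕ} (hb : 1 ≤ b) (θ : CandIdx d b K M) : MemD d (cand θ) := by
  refine ⟨cand_measurable θ, ae_of_all _ fun x => ?_, cand_integral hb θ, fun x hx => ?_⟩
  · exact Finset.sum_nonneg fun i _ => mul_nonneg (θ.1.nonneg i) (prodHist_nonneg _ _)
  · exact Finset.sum_eq_zero fun i _ => by rw [prodHist_support hb _ _ hx, mul_zero]

lemma card_candIdx (d b K M : ℕ) :
    Nat.card (CandIdx d b K M) ≤ (M + 1) ^ (K + b * d * K) := by
  rw [Nat.card_prod, pow_add, Nat.card_pi]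
  refine Nat.mul_le_mul (GridVec.card_le K M) ?_
  simp_rw [Nat.card_pi]
  simp only [Finset.prod_const, Finset.card_univ, Fintype.card_fin]
  calc ((Nat.card (GridVec b M)) ^ d) ^ K ≤ (((M + 1) ^ b) ^ d) ^ K := by
        gcongr; exact GridVec.card_le b M
    _ = _ := by rw [← pow_mul, ← pow_mul, ← mul_assoc]

/-- Approximation of a density with NL-spectrum by a candidate. -/
lemma cand_approx (d b k M : ℕ) (hb : 1 ≤ b) (hM : 1 ≤ M)
    (p : (Fin d → ℝ) → ℝ) (w L : ℕ → ℝ) (hp : MemD d p) (hs : HasNLSpectrum d p w L) :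
    ∃ θ : CandIdx d b (k + 1) M, ∫ x, |p x - cand θ x| ≤
      Real.sqrt 3 / 6 * d / b * ∑ i ∈ range (k + 1), w i * L i
      + 2 * ∑' i, w (i + (k + 1)) + 2 * ((k + 1 : ℕ) : ℝ) / M + 2 * b * d / M := by
  obtain ⟨q, hw, _, hw1, hq, hpq⟩ := hs
  obtain ⟨hpart, hsupp⟩ := spectrum_facts d p w L q hp hw hw1 hq hpq
  have hMp : (0:ℝ) < M := by exact_mod_cast hM
  have hbp : (0:ℝ) < b := by exact_mod_cast hb
  have hc : ∀ i j, Continuous (q i j) := fun i j => continuous_of_lip _ _ (hq i j).2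
  have h0 : ∀ i j x, 0 ≤ q i j x := fun i j => nonneg_of_ae _ (hc i j) (hq i j).1.2.1
  have hi : ∀ i j, Integrable (q i j) := fun i j => integrable_of_integral_one (hq i j).1.2.2
  have hpi : Integrable p := integrable_of_integral_one hp.2.2.1
  set tail := ∑' i, w (i + (k + 1)) with htail
  have htail0 : 0 ≤ tail := tsum_nonneg fun i => hw _
  have hsplit : ∑ i ∈ range (k + 1), w i + tail = 1 := by
    rw [htail, hw1.summable.sum_add_tsum_nat_add (k + 1), hw1.tsum_eq]
  have hex : ∀ (i : Fin (k + 1)) (j : Fin d), ∃ a : GridVec b M, 0 < w i →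
      ∫ x, |q i j x - stepFn b a.val' x| ≤ Real.sqrt 3 / 6 * L i / b + 2 * b / M := by
    intro i j
    by_cases hwi : 0 < w i
    · obtain ⟨v, hv0, hv1, hv⟩ := hist_bias b hb (q i j) (L i)
        (lip_pos _ _ (hq i j).2 (hq i j).1.2.2) (hq i j).2 (hc i j) (h0 i j) (hi i j)
        (hq i j).1.2.2 (hsupp i hwi j)
      obtain ⟨u, hu⟩ := GridVec.approx b M hb hM v hv0 hv1
      refine ⟨u, fun _ => ?_⟩
      have h1 := (stepFn_dist b hb v u.val').trans hu
      have e := integral_add ((hi i j).sub (stepFn_integrable b v)).abs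
        ((stepFn_integrable b v).sub (stepFn_integrable b u.val')).abs
      simp only [Pi.sub_apply] at e
      calc ∫ x, |q i j x - stepFn b u.val' x|
          ≤ ∫ x, (|q i j x - stepFn b v x| + |stepFn b v x - stepFn b u.val' x|) := by
            refine integral_mono ((hi i j).sub (stepFn_integrable b u.val')).abs
              (((hi i j).sub (stepFn_integrable b v)).abs.add
              ((stepFn_integrable b v).sub (stepFn_integrable b u.val')).abs) fun x => ?_
            exact abs_sub_le _ _ _
        _ ≤ _ := by rw [e]; linarith
    · obtain ⟨a⟩ := GridVec.nonempty b M hb hM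
      exact ⟨a, fun h => absurd h hwi⟩
  choose a ha using hex
  let wt : Fin (k + 1) → ℝ := fun i => w i + if i = 0 then tail else 0
  have hwt0 : ∀ i, 0 ≤ wt i := by
    intro i; simp only [wt]
    have := hw i
    split_ifs <;> linarith
  have hwt1 : ∑ i, wt i = 1 := by
    simp only [wt, Finset.sum_add_distrib, Finset.sum_ite_eq', Finset.mem_univ, if_true]
    rw [← hsplit, Finset.sum_range]
  obtain ⟨u, hu⟩ := GridVec.approx (k + 1) M (by omega) hM wt hwt0 hwt1
  refine ⟨(u, a), ?_⟩
  let Q : Fin (k + 1) → (Fin d → ℝ) → ℝ := fun i x => ∏ j, q i j (x j)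
  have hQi : ∀ i, Integrable (Q i) := fun i => Integrable.fintype_prod (hi i)
  have hQ1 : ∀ i, ∫ x, Q i x = 1 := fun i => by
    simp only [Q]
    rw [integral_fintype_prod_volume_eq_prod]
    exact Finset.prod_eq_one fun j _ => (hq i j).1.2.2
  have hHi : ∀ i, Integrable (prodHist (a i)) := fun i => prodHist_integrable _
  have hd : ∀ i : Fin (k + 1), w i * ∫ x, |Q i x - prodHist (a i) x| ≤
      Real.sqrt 3 / 6 * d / b * (w i * L i) + w i * (2 * b * d / M) := by
    intro i
    by_cases hwi : 0 < w i
    · have h1 := prod_dist d (fun j => q i j) (fun j => stepFn b (a i j).val') (h0 i)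
        (fun j x => stepFn_nonneg _ _ (a i j).nonneg x) (hi i) (fun j => stepFn_integrable _ _)
        (fun j => (hq i j).1.2.2)
        (fun j => by rw [stepFn_integral b hb, GridVec.sum_eq])
      have h2 : ∑ j, ∫ x, |q i j x - stepFn b (a i j).val' x| ≤
          ∑ _j : Fin d, (Real.sqrt 3 / 6 * L i / b + 2 * b / M) :=
        Finset.sum_le_sum fun j _ => ha i j hwi
      rw [Finset.sum_const, Finset.card_univ, Fintype.card_fin, nsmul_eq_mul] at h2
      have h3 := mul_le_mul_of_nonneg_left (h1.trans h2) hwi.le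
      refine h3.trans (le_of_eq ?_)
      ring
    · have : w i = 0 := le_antisymm (not_lt.1 hwi) (hw i)
      simp [this]
  -- the remainder
  let R : (Fin d → ℝ) → ℝ := fun x => p x - ∑ i : Fin (k + 1), w i * Q i x
  have hSi : Integrable (fun x => ∑ i : Fin (k + 1), w i * Q i x) :=
    integrable_finsetSum _ fun i _ => (hQi i).const_mul _
  have hRi : Integrable R := hpi.sub hSi
  have hR0 : ∀ᵐ x, 0 ≤ R x := by
    filter_upwards [hpart (range (k + 1))] with x hx
    rw [Finset.sum_range] at hx
    simp only [R, Q]; linarith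
  have hR1 : ∫ x, |R x| = tail := by
    have e : ∫ x, |R x| = ∫ x, R x := by
      refine integral_congr_ae ?_
      filter_upwards [hR0] with x hx using abs_of_nonneg hx
    rw [e]
    simp only [R]
    rw [integral_sub hpi hSi, hp.2.2.1, integral_finsetSum _ fun i _ => (hQi i).const_mul _]
    simp_rw [integral_const_mul, hQ1, mul_one]
    rw [← hsplit, Finset.sum_range]; ring
  -- pointwise bound
  have hpt : ∀ x, |p x - cand (u, a) x| ≤ |R x| + ∑ i : Fin (k + 1), w i * |Q i x - prodHist (a i) x|
      + ∑ i : Fin (k + 1), |w i - u.val' i| * prodHist (a i) x := by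
    intro x
    have e : p x - cand (u, a) x = R x + ∑ i : Fin (k + 1), w i * (Q i x - prodHist (a i) x)
        + ∑ i : Fin (k + 1), (w i - u.val' i) * prodHist (a i) x := by
      simp only [R, cand, mul_sub, sub_mul, Finset.sum_sub_distrib]
      ring
    rw [e]
    refine (abs_add_three _ _ _).trans ?_
    gcongr
    · refine (Finset.abs_sum_le_sum_abs _ _).trans (Finset.sum_le_sum fun i _ => ?_)
      rw [abs_mul, abs_of_nonneg (hw i)]
    · refine (Finset.abs_sum_le_sum_abs _ _).trans (Finset.sum_le_sum fun i _ => ?_)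
      rw [abs_mul, abs_of_nonneg (prodHist_nonneg _ _)]
  have hI2 : ∀ i : Fin (k + 1), Integrable (fun x => w i * |Q i x - prodHist (a i) x|) := fun i =>
    ((hQi i).sub (hHi i)).abs.const_mul _
  have hI3 : ∀ i : Fin (k + 1), Integrable (fun x => |w i - u.val' i| * prodHist (a i) x) := fun i =>
    (hHi i).const_mul _
  have hI2' : Integrable (fun x => ∑ i : Fin (k + 1), w i * |Q i x - prodHist (a i) x|) :=
    integrable_finsetSum _ fun i _ => hI2 i
  have hI3' : Integrable (fun x => ∑ i : Fin (k + 1), |w i - u.val' i| * prodHist (a i) x) :=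
    integrable_finsetSum _ fun i _ => hI3 i
  have hwu : ∑ i : Fin (k + 1), |w i - u.val' i| ≤ tail + 2 * ((k + 1 : ℕ) : ℝ) / M := by
    have : ∀ i : Fin (k + 1), |w i - u.val' i| ≤
        (if i = 0 then tail else 0) + |wt i - u.val' i| := by
      intro i
      have e : w i - u.val' i = -(if i = 0 then tail else 0) + (wt i - u.val' i) := by
        simp only [wt]; ring
      rw [e]
      refine (abs_add_le _ _).trans ?_
      rw [abs_neg, abs_of_nonneg]
      split_ifs <;> linarith
    refine (Finset.sum_le_sum fun i _ => this i).trans ?_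
    rw [Finset.sum_add_distrib, Finset.sum_ite_eq']
    simp only [Finset.mem_univ, if_true]
    linarith
  calc ∫ x, |p x - cand (u, a) x|
      ≤ ∫ x, (|R x| + ∑ i : Fin (k + 1), w i * |Q i x - prodHist (a i) x|
      + ∑ i : Fin (k + 1), |w i - u.val' i| * prodHist (a i) x) :=
        integral_mono (hpi.sub (cand_integrable _)).abs ((hRi.abs.add hI2').add hI3') hpt
    _ = tail + ∑ i : Fin (k + 1), w i * (∫ x, |Q i x - prodHist (a i) x|) + ∑ i : Fin (k + 1), |w i - u.val' i| := by
        have h4 : Integrable (fun x => |R x| + ∑ i : Fin (k + 1), w i * |Q i x - prodHist (a i) x|) :=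
          hRi.abs.add hI2'
        rw [integral_add h4 hI3', integral_add hRi.abs hI2', hR1,
          integral_finsetSum _ fun i _ => hI2 i, integral_finsetSum _ fun i _ => hI3 i]
        simp_rw [integral_const_mul, prodHist_integral hb, mul_one]
    _ ≤ tail + (Real.sqrt 3 / 6 * d / b * ∑ i ∈ range (k + 1), w i * L i + 2 * b * d / M)
        + (tail + 2 * ((k + 1 : ℕ) : ℝ) / M) := by
        gcongr
        refine (Finset.sum_le_sum fun i _ => hd i).trans ?_
        rw [Finset.sum_add_distrib, ← Finset.mul_sum, ← Finset.sum_mul, Finset.sum_range]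
        gcongr
        rw [← Finset.sum_range]
        have : ∑ i ∈ range (k + 1), w i ≤ 1 := by linarith
        have h5 : (0:ℝ) ≤ 2 * b * d / M := by positivity
        nlinarith
    _ = _ := by ring

lemma measurable_select {X Y I : Type*} [MeasurableSpace X] [MeasurableSpace Y] [Countable I]
    (g : Y → I) (hg : @Measurable _ _ _ ⊤ g) (f : I → X → ℝ) (hf : ∀ i, Measurable (f i)) :
    Measurable (fun z : Y × X => f (g z.1) z.2) := by
  let _ : MeasurableSpace I := ⊤
  have h1 : Measurable (fun z : I × X => f z.1 z.2) :=
    measurable_from_prod_countable_right fun i => hf i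
  exact h1.comp ((hg.comp measurable_fst).prodMk measurable_snd)

set_option maxHeartbeats 1000000 in
/-- **Theorem 3.** Finite sample bound in terms of the NL-spectrum.  The paper's
`k ∈ ℕ = {1,2,...}` is represented here as `k+1` with `k : ℕ`; sequences are `0`-indexed,
so e.g. `∑_{i=1}^{k} w_i L_i` is `∑ i ∈ range (k+1), w i * L i` and
`∑_{i=k+1}^∞ w_i` is `∑' i, w (i + (k+1))`. -/
theorem nl_spectrum_finite_sample_bound
    (d b k n : ℕ) (hd : 1 ≤ d) (hb : 1 ≤ b) (hn : 1 ≤ n)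
    (δ : ℝ) (hδ : 0 < δ) (hδ1 : δ ≤ 1) :
    ∃ V : (Fin n → Fin d → ℝ) → (Fin d → ℝ) → ℝ,
      (∀ xs, MemD d (V xs)) ∧
      Measurable (fun z : (Fin n → Fin d → ℝ) × (Fin d → ℝ) => V z.1 z.2) ∧
      ∀ (p : (Fin d → ℝ) → ℝ) (w L : ℕ → ℝ),
        MemD d p → HasNLSpectrum d p w L →
        Measure.pi (fun _ : Fin n =>
            (volume : Measure (Fin d → ℝ)).withDensity fun x => ENNReal.ofReal (p x))
          {xs | Real.sqrt 3 * d / (2 * b) * ∑ i ∈ range (k + 1), w i * L i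
              + 6 * ∑' i, w (i + (k + 1))
              + 7 * Real.sqrt (2 * (b : ℝ) * d * (k + 1)
                  * Real.log (4 * (b : ℝ) * d * (k + 1) * n) / n)
              + 7 * Real.sqrt (Real.log (3 / δ) / (2 * n))
              < ∫ x, |p x - V xs x| }
          < ENNReal.ofReal δ := by
  set D : ℕ := b * d * (k + 1) with hD
  have hD1 : 1 ≤ D := Nat.mul_pos (Nat.mul_pos hb hd) (Nat.succ_pos k)
  have hDn1 : 1 ≤ D * n := Nat.mul_pos hD1 hn
  obtain ⟨M, hM⟩ : ∃ M, M + 1 = 4 * (D * n) := ⟨4 * (D * n) - 1, by omega⟩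
  have hM1 : 1 ≤ M := by omega
  have hM3 : 3 * (D * n) ≤ M := by omega
  have hne : Nonempty (CandIdx d b (k + 1) M) := by
    obtain ⟨u⟩ := GridVec.nonempty (k + 1) M (by omega) hM1
    obtain ⟨a⟩ := GridVec.nonempty b M hb hM1
    exact ⟨(u, fun _ _ => a)⟩
  obtain ⟨g, hgm, hg⟩ := min_distance (volume : Measure (Fin d → ℝ))
    (cand (d := d) (b := b) (K := k + 1) (M := M)) cand_measurable cand_integrable
    (cand_integral hb) n hn
  refine ⟨fun xs => cand (g xs), fun xs => cand_memD hb _, ?_, ?_⟩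
  · exact measurable_select g hgm cand cand_measurable
  intro p w L hp hs
  obtain ⟨θ, hθ⟩ := cand_approx d b k M hb hM1 p w L hp hs
  have hDr : (D : ℝ) = b * d * (k + 1) := by rw [hD]; push_cast; ring
  have hbp : (1:ℝ) ≤ b := by exact_mod_cast hb
  have hdp : (1:ℝ) ≤ d := by exact_mod_cast hd
  have hnp : (1:ℝ) ≤ n := by exact_mod_cast hn
  have hDp : (1:ℝ) ≤ D := by exact_mod_cast hD1
  have hDnp : (1:ℝ) ≤ (D * n : ℝ) := by exact_mod_cast hDn1
  have hMr : (M : ℝ) + 1 = 4 * (D * n) := by exact_mod_cast hM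
  have hM3r : 3 * ((D : ℝ) * n) ≤ M := by exact_mod_cast hM3
  have hMp : (0:ℝ) < M := by exact_mod_cast hM1
  have e1 : 2 * (b : ℝ) * d * (k + 1) = 2 * D := by rw [hDr]; ring
  have e2 : 4 * (b : ℝ) * d * (k + 1) * n = 4 * (D * n) := by rw [hDr]; ring
  rw [e1, e2]
  set ℓ := Real.log (4 * ((D:ℝ) * n)) with hℓ
  set ℓ' := Real.log (3 / δ) with hℓ'
  have hℓ1 : 1 ≤ ℓ := by
    rw [hℓ, Real.le_log_iff_exp_le (by positivity)]
    have := Real.exp_one_lt_d9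
    nlinarith
  have hℓ'0 : 0 ≤ ℓ' := Real.log_nonneg (by rw [le_div_iff₀ hδ]; linarith)
  set A := Real.sqrt (2 * D * ℓ / n) with hA
  set B := Real.sqrt (ℓ' / (2 * n)) with hB
  have hA2 : A ^ 2 = 2 * D * ℓ / n := Real.sq_sqrt (by positivity)
  have hB2 : B ^ 2 = ℓ' / (2 * n) := Real.sq_sqrt (by positivity)
  have hA0 : 0 ≤ A := Real.sqrt_nonneg _
  have hB0 : 0 ≤ B := Real.sqrt_nonneg _
  -- the discretisation error is absorbed
  have hdisc : 3 * (2 * ((k + 1 : ℕ) : ℝ) / M + 2 * b * d / M) ≤ 3 * A := by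
    have h1 : 2 * ((k + 1 : ℕ) : ℝ) / M + 2 * b * d / M ≤ 4 / (3 * n) := by
      rw [← add_div, div_le_div_iff₀ hMp (by positivity)]
      have h2 : ((k + 1 : ℕ) : ℝ) ≤ D := by
        have : k + 1 ≤ D := Nat.le_mul_of_pos_left _ (Nat.mul_pos hb hd)
        exact_mod_cast this
      have h3 : (b:ℝ) * d ≤ D := by
        have : b * d ≤ D := Nat.le_mul_of_pos_right _ (Nat.succ_pos k)
        exact_mod_cast this
      have h4 : 2 * ((k + 1 : ℕ) : ℝ) + 2 * b * d ≤ 4 * D := by linarith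
      have h5 := mul_le_mul_of_nonneg_right h4 (by positivity : (0:ℝ) ≤ 3 * n)
      nlinarith
    have h6 : 4 / (3 * (n:ℝ)) ≤ A := by
      refine Real.le_sqrt_of_sq_le ?_
      have : (2:ℝ) / n ≤ 2 * D * ℓ / n := by
        gcongr
        nlinarith
      refine le_trans ?_ this
      rw [div_pow, div_le_div_iff₀ (by positivity) (by positivity)]
      nlinarith
    linarith
  have hsub : {xs : Fin n → Fin d → ℝ | Real.sqrt 3 * d / (2 * b) * ∑ i ∈ range (k + 1), w i * L i
              + 6 * ∑' i, w (i + (k + 1)) + 7 * A + 7 * B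
              < ∫ x, |p x - cand (g xs) x| } ⊆
      {xs | 3 * (∫ x, |p x - cand θ x|) + 4 * (A + B) < ∫ x, |p x - cand (g xs) x|} := by
    intro xs hxs
    simp only [Set.mem_ofPred_eq] at hxs ⊢
    refine lt_of_le_of_lt ?_ hxs
    have e3 : Real.sqrt 3 * d / (2 * b) * ∑ i ∈ range (k + 1), w i * L i =
        3 * (Real.sqrt 3 / 6 * d / b * ∑ i ∈ range (k + 1), w i * L i) := by
      field_simp
      ring
    rw [e3]
    linarith
  refine (measure_mono hsub).trans_lt ?_
  refine (hg p (integrable_of_integral_one hp.2.2.1) hp.2.1 hp.2.2.1 θ (A + B)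
    (by positivity)).trans_lt ?_
  rw [ENNReal.ofReal_lt_ofReal_iff hδ]
  set Y : ℝ := 4 * ((D:ℝ) * n) with hY
  have hY1 : 1 ≤ Y := by linarith
  have hcard : (Nat.card (CandIdx d b (k + 1) M) : ℝ) ≤ Y ^ (2 * D) := by
    have h1 := card_candIdx d b (k + 1) M
    have h2 : (Nat.card (CandIdx d b (k + 1) M) : ℝ) ≤ ((M:ℝ) + 1) ^ (k + 1 + b * d * (k + 1)) := by
      exact_mod_cast h1
    rw [hMr] at h2
    refine h2.trans (pow_le_pow_right₀ hY1 ?_)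
    have : k + 1 ≤ D := Nat.le_mul_of_pos_left _ (Nat.mul_pos hb hd)
    omega
  have hcard2 : (Nat.card (CandIdx d b (k + 1) M) : ℝ) ^ 2 ≤ Y ^ (4 * D) := by
    calc _ ≤ (Y ^ (2 * D)) ^ 2 := by gcongr
      _ = Y ^ (4 * D) := by rw [← pow_mul]; congr 1; ring
  have hexp : Real.exp (-2 * n * (A + B) ^ 2) ≤ (Y ^ (4 * D))⁻¹ * (δ / 3) := by
    have h1 : -2 * n * (A + B) ^ 2 ≤ -((4 * D : ℕ) * ℓ) + -ℓ' := by
      have h2 : A ^ 2 + B ^ 2 ≤ (A + B) ^ 2 := by nlinarith [mul_nonneg hA0 hB0]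
      have h3 : 2 * n * (A ^ 2 + B ^ 2) = (4 * D : ℕ) * ℓ + ℓ' := by
        rw [hA2, hB2]; push_cast; field_simp; ring
      have h4 := mul_le_mul_of_nonneg_left h2 (by positivity : (0:ℝ) ≤ 2 * n)
      linarith
    refine (Real.exp_le_exp.2 h1).trans (le_of_eq ?_)
    rw [Real.exp_add, Real.exp_neg, Real.exp_neg, Real.exp_nat_mul, hℓ, hℓ',
      Real.exp_log (by positivity), Real.exp_log (by positivity), inv_div]
  calc _ ≤ Y ^ (4 * D) * (2 * ((Y ^ (4 * D))⁻¹ * (δ / 3))) := by gcongr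
    _ = 2 * (δ / 3) := by
        have : Y ^ (4 * D) ≠ 0 := by positivity
        field_simp
    _ < δ := by linarith
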